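/- Let 1 < p < ∞ and assume ∑_{n=0}^∞ λ_n^{-p} < ∞, and let n ≥ 2 be a natural number. Then the strong n-th James constant of Λ_p equals n; that is, sup{ min over all sign choices ε_j ∈ {−1, +1} of ‖∑_{j=0}^{n−1} ε_j x_j‖_p : x_0, …, x_{n−1} real sequences with ‖x_j‖_p = 1 for each j } = n. -/

import Mathlib

open Filter Topology

/-- Weight `λ_k − λ_{k−1}` with the convention `λ_{−1} = 0`. -/
noncomputable def dLam (l : ℕ → ℝ) (k : ℕ) : ℝ :=
  l k - (if k = 0 then 0 else l (k - 1))

/-- `Λx(n) = (1/λ_n) ∑_{k=0}^n (λ_k − λ_{k−1})|x_k|`. -/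
noncomputable def LamAvg (l : ℕ → ℝ) (x : ℕ → ℝ) (n : ℕ) : ℝ :=
  (1 / l n) * ∑ k ∈ Finset.range (n + 1), dLam l k * |x k|

/-- The norm of the space `Λ_p`, `‖x‖_p = (∑_{n=0}^∞ (Λx(n))^p)^{1/p}`. -/
noncomputable def LamNorm (l : ℕ → ℝ) (p : ℝ) (x : ℕ → ℝ) : ℝ :=
  (∑' n : ℕ, (LamAvg l x n) ^ p) ^ (1 / p)

theorem dLam_pos {l : ℕ → ℝ} (hpos : ∀ k, 0 < l k) (hmono : StrictMono l) (k : ℕ) :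
    0 < dLam l k := by
  unfold dLam
  split_ifs with h
  · simpa using hpos k
  · exact sub_pos.2 (hmono (by omega))

theorem LamAvg_nonneg {l : ℕ → ℝ} (hpos : ∀ k, 0 < l k) (hmono : StrictMono l)
    (x : ℕ → ℝ) (m : ℕ) : 0 ≤ LamAvg l x m :=
  mul_nonneg (one_div_nonneg.2 (hpos m).le)
    (Finset.sum_nonneg fun k _ => mul_nonneg (dLam_pos hpos hmono k).le (abs_nonneg _))

theorem LamAvg_add_le {l : ℕ → ℝ} (hpos : ∀ k, 0 < l k) (hmono : StrictMono l)
    (x y : ℕ → ℝ) (m : ℕ) :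
    LamAvg l (fun k => x k + y k) m ≤ LamAvg l x m + LamAvg l y m := by
  unfold LamAvg
  rw [← mul_add, ← Finset.sum_add_distrib]
  refine mul_le_mul_of_nonneg_left (Finset.sum_le_sum fun k _ => ?_)
    (one_div_nonneg.2 (hpos m).le)
  rw [← mul_add]
  exact mul_le_mul_of_nonneg_left (abs_add_le _ _) (dLam_pos hpos hmono k).le

theorem LamNorm_nonneg {l : ℕ → ℝ} (hpos : ∀ k, 0 < l k) (hmono : StrictMono l) (p : ℝ)
    (x : ℕ → ℝ) : 0 ≤ LamNorm l p x :=
  Real.rpow_nonneg (tsum_nonneg fun m => Real.rpow_nonneg (LamAvg_nonneg hpos hmono x m) _) _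

theorem LamNorm_sign_mul (l : ℕ → ℝ) (p : ℝ) {e : ℝ} (he : e = 1 ∨ e = -1) (x : ℕ → ℝ) :
    LamNorm l p (fun k => e * x k) = LamNorm l p x := by
  rcases he with rfl | rfl <;> simp [LamNorm, LamAvg]

theorem summable_of_LamNorm_ne_zero {l : ℕ → ℝ} {p : ℝ} (hp : 1 < p) {x : ℕ → ℝ}
    (hx : LamNorm l p x ≠ 0) : Summable fun m => (LamAvg l x m) ^ p := by
  by_contra h
  refine hx ?_
  rw [LamNorm, tsum_eq_zero_of_not_summable h, Real.zero_rpow]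
  positivity

/-- Minkowski's inequality for finite sums in `Λ_p`. -/
theorem summable_and_LamNorm_sum_le {l : ℕ → ℝ} {p : ℝ} (hpos : ∀ k, 0 < l k)
    (hmono : StrictMono l) (hp : 1 < p) {ι : Type*} (s : Finset ι) (x : ι → ℕ → ℝ)
    (hx : ∀ j, Summable fun m => (LamAvg l (x j) m) ^ p) :
    (Summable fun m => (LamAvg l (fun k => ∑ j ∈ s, x j k) m) ^ p) ∧
      LamNorm l p (fun k => ∑ j ∈ s, x j k) ≤ ∑ j ∈ s, LamNorm l p (x j) := by
  classical
  have hp0 : p ≠ 0 := by positivity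
  induction s using Finset.induction_on with
  | empty =>
    simp [LamNorm, LamAvg, hp0]
  | insert a s ha ih =>
    simp only [Finset.sum_insert ha]
    obtain ⟨hs, hle⟩ := ih
    have hle' := fun m => LamAvg_add_le hpos hmono (x a) (fun k => ∑ j ∈ s, x j k) m
    obtain ⟨h1, h2⟩ := Real.Lp_add_le_tsum_of_nonneg hp.le
      (fun m => LamAvg_nonneg hpos hmono (x a) m)
      (fun m => LamAvg_nonneg hpos hmono (fun k => ∑ j ∈ s, x j k) m) (hx a) hs
    have hpow := fun m => Real.rpow_le_rpow (LamAvg_nonneg hpos hmono _ m) (hle' m)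
      (zero_le_one.trans hp.le)
    have h3 := Summable.of_nonneg_of_le
      (fun m => Real.rpow_nonneg (LamAvg_nonneg hpos hmono _ m) p) hpow h1
    refine ⟨h3, le_trans ?_ (h2.trans (add_le_add le_rfl hle))⟩
    exact Real.rpow_le_rpow
      (tsum_nonneg fun m => Real.rpow_nonneg (LamAvg_nonneg hpos hmono _ m) _)
      (h3.tsum_le_tsum hpow h1) (by positivity)

/-- The tail `∑_{m ≥ k} λ_m^{-p}`. -/
noncomputable def lamTail (l : ℕ → ℝ) (p : ℝ) (k : ℕ) : ℝ := ∑' i, l (i + k) ^ (-p)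

theorem lamTail_pos {l : ℕ → ℝ} {p : ℝ} (hpos : ∀ k, 0 < l k)
    (hsum : Summable fun m => (l m) ^ (-p)) (k : ℕ) : 0 < lamTail l p k :=
  ((summable_nat_add_iff k).2 hsum).tsum_pos
    (fun _ => Real.rpow_nonneg (hpos _).le _) 0 (Real.rpow_pos_of_pos (hpos _) _)

theorem sum_add_lamTail {l : ℕ → ℝ} {p : ℝ} (hsum : Summable fun m => (l m) ^ (-p))
    (k n : ℕ) :
    ∑ i ∈ Finset.range n, l (i + k) ^ (-p) + lamTail l p (k + n) = lamTail l p k := by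
  have h := ((summable_nat_add_iff k).2 hsum).sum_add_tsum_nat_add n
  simpa only [lamTail, add_assoc, add_comm n k] using h

theorem tendsto_shift_ratio {l : ℕ → ℝ} (hpos : ∀ k, 0 < l k)
    (hratio : Tendsto (fun k => l (k + 1) / l k) atTop (𝓝 1)) (N : ℕ) :
    Tendsto (fun k => l (k + N) / l k) atTop (𝓝 1) := by
  induction N with
  | zero => simp [div_self (hpos _).ne']
  | succ N ih =>
    have h := (hratio.comp (tendsto_add_atTop_nat N)).mul ih
    rw [one_mul] at h
    refine h.congr fun k => ?_
    have := (hpos (k + N)).ne'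
    have := (hpos k).ne'
    simp only [Function.comp, ← add_assoc]
    field_simp

/-- The tails of `∑ λ_m^{-p}` vary slowly. -/
theorem exists_lamTail_add_ge {l : ℕ → ℝ} {p : ℝ} (hpos : ∀ k, 0 < l k) (hmono : StrictMono l)
    (hratio : Tendsto (fun k => l (k + 1) / l k) atTop (𝓝 1)) (hp : 1 < p)
    (hsum : Summable fun m => (l m) ^ (-p)) (n : ℕ) {δ : ℝ} (hδ : 0 < δ) :
    ∃ k, (1 - δ) * lamTail l p k ≤ lamTail l p (k + n) := by
  have hp0 : 0 < p := by linarith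
  obtain ⟨N, hN⟩ := exists_nat_gt (n * (2 : ℝ) ^ p / δ)
  obtain ⟨k, hk⟩ := ((tendsto_shift_ratio hpos hratio N).eventually_le_const
    (by norm_num : (1 : ℝ) < 2)).exists
  rw [div_le_iff₀ (hpos k)] at hk
  refine ⟨k, ?_⟩
  have hanti : ∀ {a b : ℕ}, a ≤ b → l b ^ (-p) ≤ l a ^ (-p) := fun h =>
    Real.rpow_le_rpow_of_nonpos (hpos _) (hmono.monotone h) (by linarith)
  have hup : ∑ i ∈ Finset.range n, l (i + k) ^ (-p) ≤ n * l k ^ (-p) := by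
    have := Finset.sum_le_card_nsmul (Finset.range n) (fun i => l (i + k) ^ (-p)) (l k ^ (-p))
      fun i _ => hanti (by omega)
    simpa using this
  have hlow : N * l (k + N) ^ (-p) ≤ lamTail l p k := by
    rw [← sum_add_lamTail hsum k N]
    have := Finset.card_nsmul_le_sum (Finset.range N) (fun i => l (i + k) ^ (-p))
      (l (k + N) ^ (-p)) fun i hi => hanti (by have := Finset.mem_range.1 hi; omega)
    have h2 := lamTail_pos hpos hsum (k + N)
    simp only [Finset.card_range, nsmul_eq_mul] at this
    linarith
  have hcmp : l k ^ (-p) ≤ 2 ^ p * l (k + N) ^ (-p) := by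
    have h := Real.rpow_le_rpow_of_nonpos (hpos _) hk (by linarith : -p ≤ 0)
    rw [Real.mul_rpow (by norm_num) (hpos k).le, Real.rpow_neg (by norm_num)] at h
    have h2 : (0 : ℝ) < 2 ^ p := by positivity
    calc l k ^ (-p) = 2 ^ p * ((2 ^ p)⁻¹ * l k ^ (-p)) := by field_simp
      _ ≤ _ := mul_le_mul_of_nonneg_left h h2.le
  have hq : 0 < l (k + N) ^ (-p) := Real.rpow_pos_of_pos (hpos _) _
  rw [div_lt_iff₀ hδ] at hN
  have h1 : n * l k ^ (-p) ≤ δ * lamTail l p k :=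
    calc n * l k ^ (-p) ≤ n * (2 ^ p * l (k + N) ^ (-p)) := by gcongr
      _ = (n * 2 ^ p) * l (k + N) ^ (-p) := by ring
      _ ≤ (N * δ) * l (k + N) ^ (-p) := by gcongr
      _ = δ * (N * l (k + N) ^ (-p)) := by ring
      _ ≤ _ := by gcongr
  have := sum_add_lamTail hsum k n
  linarith

theorem hasSum_ite_rpow {l : ℕ → ℝ} {p : ℝ} (hpos : ∀ k, 0 < l k) (hp : 1 < p)
    (hsum : Summable fun m => (l m) ^ (-p)) (k : ℕ) {c : ℝ} (hc : 0 ≤ c) :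
    HasSum (fun m => (if k ≤ m then 1 / l m * c else 0) ^ p) (c ^ p * lamTail l p k) := by
  rw [← hasSum_nat_add_iff' k, Finset.sum_eq_zero, sub_zero]
  · refine (((summable_nat_add_iff k).2 hsum).hasSum.mul_left (c ^ p)).congr_fun fun i => ?_
    have := (hpos (i + k)).le
    rw [if_pos (by omega), Real.mul_rpow (by positivity) hc, one_div, Real.inv_rpow this,
      Real.rpow_neg this, mul_comm]
  · intro i hi
    rw [if_neg (by have := Finset.mem_range.1 hi; omega), Real.zero_rpow (by linarith)]

/-- The multiple of the `k`-th unit vector which has norm one in `Λ_p`. -/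
noncomputable def unitVec (l : ℕ → ℝ) (p : ℝ) (k : ℕ) : ℕ → ℝ :=
  Pi.single k (lamTail l p k ^ (-(1 / p)) / dLam l k)

theorem LamAvg_unitVec {l : ℕ → ℝ} {p : ℝ} (hpos : ∀ k, 0 < l k) (hmono : StrictMono l)
    (hsum : Summable fun m => (l m) ^ (-p)) (k m : ℕ) :
    LamAvg l (unitVec l p k) m =
      if k ≤ m then 1 / l m * lamTail l p k ^ (-(1 / p)) else 0 := by
  have hd := dLam_pos hpos hmono k
  have hT := Real.rpow_pos_of_pos (lamTail_pos hpos hsum k) (-(1 / p))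
  unfold LamAvg
  split_ifs with h
  · rw [Finset.sum_eq_single_of_mem k (Finset.mem_range.2 (by omega))]
    · rw [unitVec, Pi.single_eq_same, abs_of_pos (div_pos hT hd), mul_div_cancel₀ _ hd.ne']
    · intro b _ hb
      simp [unitVec, hb]
  · rw [Finset.sum_eq_zero, mul_zero]
    intro b hb
    have : b ≠ k := by have := Finset.mem_range.1 hb; omega
    simp [unitVec, this]

theorem LamNorm_unitVec {l : ℕ → ℝ} {p : ℝ} (hpos : ∀ k, 0 < l k) (hmono : StrictMono l)
    (hp : 1 < p) (hsum : Summable fun m => (l m) ^ (-p)) (k : ℕ) :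
    LamNorm l p (unitVec l p k) = 1 := by
  have hT := lamTail_pos hpos hsum k
  have hp0 : p ≠ 0 := by positivity
  simp only [LamNorm, LamAvg_unitVec hpos hmono hsum]
  rw [(hasSum_ite_rpow hpos hp hsum k (Real.rpow_nonneg hT.le _)).tsum_eq, ← Real.rpow_mul hT.le]
  have : -(1 / p) * p = -1 := by field_simp
  rw [this, Real.rpow_neg_one, inv_mul_cancel₀ hT.ne', Real.one_rpow]

theorem LamAvg_sum_unitVec (l : ℕ → ℝ) (p : ℝ) {n : ℕ} (k m : ℕ) (ε : Fin n → ℝ)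
    (hε : ∀ j, ε j = 1 ∨ ε j = -1) :
    LamAvg l (fun i => ∑ j, ε j * unitVec l p (k + j) i) m =
      ∑ j : Fin n, LamAvg l (unitVec l p (k + j)) m := by
  have habs : ∀ i, |∑ j, ε j * unitVec l p (k + j) i| =
      ∑ j : Fin n, |unitVec l p (k + j) i| := by
    intro i
    by_cases h : ∃ j : Fin n, i = k + j
    · obtain ⟨j, rfl⟩ := h
      have hz : ∀ b : Fin n, b ≠ j → unitVec l p (k + b) (k + j) = 0 := fun b hb => by
        have : (j : ℕ) ≠ b := fun h => hb (Fin.ext h.symm)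
        simp [unitVec, this]
      rw [Finset.sum_eq_single j (fun b _ hb => by simp [hz b hb]) (by simp),
        Finset.sum_eq_single j (fun b _ hb => by simp [hz b hb]) (by simp)]
      rcases hε j with h | h <;> simp [h]
    · have hz : ∀ b : Fin n, unitVec l p (k + b) i = 0 := fun b => by
        have : i ≠ k + b := fun hb => h ⟨b, hb⟩
        simp [unitVec, this]
      simp [hz]
  simp only [LamAvg, habs, Finset.mul_sum]
  exact Finset.sum_comm

theorem LamNorm_sum_unitVec_ge {l : ℕ → ℝ} {p : ℝ} (hpos : ∀ k, 0 < l k)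
    (hmono : StrictMono l) (hp : 1 < p) (hsum : Summable fun m => (l m) ^ (-p))
    {n k : ℕ} {δ : ℝ} (hδ : 0 < δ) (hδ1 : δ < 1)
    (hk : (1 - δ) * lamTail l p k ≤ lamTail l p (k + n)) (ε : Fin n → ℝ)
    (hε : ∀ j, ε j = 1 ∨ ε j = -1) :
    n * (1 - δ) ≤ LamNorm l p (fun i => ∑ j, ε j * unitVec l p (k + j) i) := by
  have hp0 : 0 < p := by linarith
  have hT := lamTail_pos hpos hsum k
  set c : ℝ := n * lamTail l p k ^ (-(1 / p)) with hc_def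
  have hc : 0 ≤ c := mul_nonneg (Nat.cast_nonneg n) (Real.rpow_nonneg hT.le _)
  have hS := hasSum_ite_rpow hpos hp hsum (k + n) hc
  have hsummable := (summable_and_LamNorm_sum_le hpos hmono hp Finset.univ
    (fun j i => ε j * unitVec l p (k + j) i) fun j => summable_of_LamNorm_ne_zero hp (by
      rw [LamNorm_sign_mul l p (hε j), LamNorm_unitVec hpos hmono hp hsum]
      exact one_ne_zero)).1
  have hpt : ∀ m, (if k + n ≤ m then 1 / l m * c else 0) ^ p ≤
      (LamAvg l (fun i => ∑ j, ε j * unitVec l p (k + j) i) m) ^ p := by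
    intro m
    split_ifs with h
    · refine Real.rpow_le_rpow (mul_nonneg (one_div_nonneg.2 (hpos m).le) hc) ?_ hp0.le
      rw [LamAvg_sum_unitVec l p k m ε hε]
      have := Finset.card_nsmul_le_sum (Finset.univ : Finset (Fin n))
        (fun j => LamAvg l (unitVec l p (k + j)) m) (1 / l m * lamTail l p k ^ (-(1 / p))) ?_
      · simp only [Finset.card_univ, Fintype.card_fin, nsmul_eq_mul] at this
        refine le_trans (le_of_eq ?_) this
        rw [hc_def]; ring
      · intro j _
        rw [LamAvg_unitVec hpos hmono hsum, if_pos (by have := j.2; omega)]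
        refine mul_le_mul_of_nonneg_left ?_ (one_div_nonneg.2 (hpos m).le)
        refine Real.rpow_le_rpow_of_nonpos (lamTail_pos hpos hsum _) ?_
          (neg_nonpos.2 (by positivity))
        rw [← sum_add_lamTail hsum k j]
        exact le_add_of_nonneg_left
          (Finset.sum_nonneg fun i _ => Real.rpow_nonneg (hpos _).le _)
    · rw [Real.zero_rpow hp0.ne']
      exact Real.rpow_nonneg (LamAvg_nonneg hpos hmono _ m) _
  have htsum := hS.summable.tsum_le_tsum hpt hsummable
  rw [hS.tsum_eq] at htsum
  have h1δ : 0 < 1 - δ := by linarith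
  have hlow : (n * (1 - δ)) ^ p ≤ c ^ p * lamTail l p (k + n) :=
    calc ((n : ℝ) * (1 - δ)) ^ p = (n : ℝ) ^ p * (1 - δ) ^ p :=
          Real.mul_rpow (Nat.cast_nonneg n) h1δ.le
      _ ≤ (n : ℝ) ^ p * (1 - δ) := by
          gcongr
          simpa using Real.rpow_le_rpow_of_exponent_ge h1δ (by linarith) hp.le
      _ = c ^ p * ((1 - δ) * lamTail l p k) := by
          have h1 : -(1 / p) * p = -1 := by field_simp
          rw [hc_def, Real.mul_rpow (Nat.cast_nonneg n) (Real.rpow_nonneg hT.le _),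
            ← Real.rpow_mul hT.le, h1, Real.rpow_neg_one]
          field_simp
      _ ≤ _ := mul_le_mul_of_nonneg_left hk (Real.rpow_nonneg hc _)
  have h0 : 0 ≤ (n : ℝ) * (1 - δ) := by positivity
  calc (n : ℝ) * (1 - δ) = (((n : ℝ) * (1 - δ)) ^ p) ^ (1 / p) := by
        rw [← Real.rpow_mul h0, mul_one_div_cancel hp0.ne', Real.rpow_one]
    _ ≤ _ := Real.rpow_le_rpow (Real.rpow_nonneg h0 _) (hlow.trans htsum) (by positivity)

/-- The strong `n`-th James constant of `Λ_p` equals `n` for `1 < p < ∞`. -/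
theorem strong_nth_james_constant_LamP (l : ℕ → ℝ) (p : ℝ) (n : ℕ)
    (hpos : ∀ k, 0 < l k) (hmono : StrictMono l)
    (htop : Tendsto l atTop atTop)
    (hratio : Tendsto (fun k => l (k + 1) / l k) atTop (𝓝 1))
    (hp : 1 < p)
    (hsum : Summable fun m => (l m) ^ (-p))
    (hn : 2 ≤ n) :
    sSup {r : ℝ | ∃ x : Fin n → (ℕ → ℝ), (∀ j, LamNorm l p (x j) = 1) ∧
      r = sInf {s : ℝ | ∃ ε : Fin n → ℝ, (∀ j, ε j = 1 ∨ ε j = -1) ∧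
        s = LamNorm l p (fun k => ∑ j, ε j * x j k)}} = n := by
  have hub : ∀ r ∈ {r : ℝ | ∃ x : Fin n → (ℕ → ℝ), (∀ j, LamNorm l p (x j) = 1) ∧
      r = sInf {s : ℝ | ∃ ε : Fin n → ℝ, (∀ j, ε j = 1 ∨ ε j = -1) ∧
        s = LamNorm l p (fun k => ∑ j, ε j * x j k)}}, r ≤ n := by
    rintro r ⟨x, hx, rfl⟩
    refine le_trans (csInf_le ⟨0, ?_⟩ ⟨fun _ => 1, fun _ => Or.inl rfl, rfl⟩) ?_
    · rintro s ⟨ε, -, rfl⟩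
      exact LamNorm_nonneg hpos hmono p _
    · simpa [hx] using (summable_and_LamNorm_sum_le hpos hmono hp Finset.univ x fun j =>
        summable_of_LamNorm_ne_zero hp (by rw [hx j]; exact one_ne_zero)).2
  have hmem : ∀ k, ∃ x : Fin n → (ℕ → ℝ), (∀ j, LamNorm l p (x j) = 1) ∧
      sInf {s : ℝ | ∃ ε : Fin n → ℝ, (∀ j, ε j = 1 ∨ ε j = -1) ∧
        s = LamNorm l p (fun i => ∑ j, ε j * unitVec l p (k + j) i)} =
      sInf {s : ℝ | ∃ ε : Fin n → ℝ, (∀ j, ε j = 1 ∨ ε j = -1) ∧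
        s = LamNorm l p (fun k => ∑ j, ε j * x j k)} := fun k =>
    ⟨fun j => unitVec l p (k + j), fun j => LamNorm_unitVec hpos hmono hp hsum _, rfl⟩
  refine le_antisymm (csSup_le ⟨_, hmem 0⟩ hub) ?_
  have hn0 : (0 : ℝ) < n := by exact_mod_cast (by omega : 0 < n)
  refine le_of_forall_pos_le_add fun e he => ?_
  have hδ : 0 < min (e / n) (1 / 2) := lt_min (by positivity) (by norm_num)
  have hδ1 : min (e / n) (1 / 2) < 1 := (min_le_right _ _).trans_lt (by norm_num)
  obtain ⟨k, hk⟩ := exists_lamTail_add_ge hpos hmono hratio hp hsum n hδ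
  have hsup := le_csSup (Exists.intro (n : ℝ) hub) (hmem k)
  have hinf : n * (1 - min (e / n) (1 / 2)) ≤
      sInf {s : ℝ | ∃ ε : Fin n → ℝ, (∀ j, ε j = 1 ∨ ε j = -1) ∧
        s = LamNorm l p (fun i => ∑ j, ε j * unitVec l p (k + j) i)} := by
    refine le_csInf ⟨_, fun _ => 1, fun _ => Or.inl rfl, rfl⟩ ?_
    rintro s ⟨ε, hε, rfl⟩
    exact LamNorm_sum_unitVec_ge hpos hmono hp hsum hδ hδ1 hk ε hε
  have hne : n * min (e / n) (1 / 2) ≤ e :=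
    calc n * min (e / n) (1 / 2) ≤ n * (e / n) := by gcongr; exact min_le_left _ _
      _ = e := by field_simp
  linarith
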